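/- arXiv:2005.09505 — 2 statements merged into one kernel-verified Lean document; each statement's English description precedes it below -/
import Mathlib

section
/- Let Ω ⊆ ℂⁿ be a bounded domain and let u be a function on Ω with u⁺ = max{u, 0} ∈ ℳ. If u⁺ is tame, then there exists an increasing convex function φ: [-∞, +∞] → [0, +∞] with lim inf_{t→+∞} φ(t)/t = +∞ such that φ∘u admits a plurisuperharmonic majorant on Ω. -/
open Complex Polynomial Filter Set Topology

noncomputable section

/-- `u` is plurisubharmonic on `Ω ⊆ ℂⁿ`: it is upper semicontinuous on `Ω`, takes values in
`[-∞, ∞)`, is not identically `-∞`, and on every closed disc of every complex line contained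
in `Ω` it satisfies the maximum principle against real parts of complex polynomials
(an equivalent formulation of subharmonicity of the restriction to every complex line). -/
def IsPSH {n : ℕ} (Ω : Set (Fin n → ℂ)) (u : (Fin n → ℂ) → EReal) : Prop :=
  UpperSemicontinuousOn u Ω ∧
  (∀ z ∈ Ω, u z ≠ ⊤) ∧
  (∃ z ∈ Ω, u z ≠ ⊥) ∧
  ∀ z ∈ Ω, ∀ w : Fin n → ℂ, ∀ r : ℝ, 0 < r →
    (∀ ζ : ℂ, ‖ζ‖ ≤ r → z + ζ • w ∈ Ω) →
    ∀ p : Polynomial ℂ,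
      (∀ ζ : ℂ, ‖ζ‖ = r → u (z + ζ • w) ≤ (((p.eval ζ).re : ℝ) : EReal)) →
      ∀ ζ : ℂ, ‖ζ‖ ≤ r → u (z + ζ • w) ≤ (((p.eval ζ).re : ℝ) : EReal)

/-- `v` is plurisuperharmonic on `Ω` iff `-v` is plurisubharmonic on `Ω`. -/
def IsPSupH {n : ℕ} (Ω : Set (Fin n → ℂ)) (v : (Fin n → ℂ) → EReal) : Prop :=
  IsPSH Ω (fun z => -(v z))

/-- `f` belongs to the class `ℳ`: `f : Ω → [0, +∞]` admits a plurisuperharmonic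
majorant on `Ω`. -/
def MemM {n : ℕ} (Ω : Set (Fin n → ℂ)) (f : (Fin n → ℂ) → EReal) : Prop :=
  (∀ z ∈ Ω, 0 ≤ f z) ∧ ∃ v, IsPSupH Ω v ∧ ∀ z ∈ Ω, f z ≤ v z

/-- The reduced function `R_λ f`: the pointwise infimum of all plurisuperharmonic
majorants of `(f - λ)⁺ = max {f - λ, 0}` on `Ω`. -/
def Rop {n : ℕ} (Ω : Set (Fin n → ℂ)) (f : (Fin n → ℂ) → EReal) (lam : ℝ)
    (z : Fin n → ℂ) : EReal :=
  sInf { y | ∃ v, IsPSupH Ω v ∧ (∀ ζ ∈ Ω, max (f ζ - (lam : EReal)) 0 ≤ v ζ) ∧ y = v z }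

/-- Lower semicontinuous regularization of `g` relative to the set `A`:
`g_*(z) = liminf_{A ∋ ζ → z} g(ζ)`. -/
def lscReg {n : ℕ} (A : Set (Fin n → ℂ)) (g : (Fin n → ℂ) → EReal)
    (z : Fin n → ℂ) : EReal :=
  liminf g (nhdsWithin z A)

/-- Upper semicontinuous regularization of `g` relative to the set `A`:
`g*(z) = limsup_{A ∋ ζ → z} g(ζ)`. -/
def uscReg {n : ℕ} (A : Set (Fin n → ℂ)) (g : (Fin n → ℂ) → EReal)
    (z : Fin n → ℂ) : EReal :=
  limsup g (nhdsWithin z A)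

/-- `S_λ f`: the lower semicontinuous regularization of `R_λ f` on `Ω`. -/
def Slam {n : ℕ} (Ω : Set (Fin n → ℂ)) (f : (Fin n → ℂ) → EReal) (lam : ℝ) :
    (Fin n → ℂ) → EReal :=
  lscReg Ω (Rop Ω f lam)

/-- The operator `S`: the lower semicontinuous regularization of
`lim_{λ → ∞} S_λ f`; since `λ ↦ S_λ f` is decreasing on `λ ≥ 0`, this limit is the
infimum over `λ ≥ 0`. -/
def Sop {n : ℕ} (Ω : Set (Fin n → ℂ)) (f : (Fin n → ℂ) → EReal) :
    (Fin n → ℂ) → EReal :=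
  lscReg Ω (fun z => ⨅ (lam : ℝ) (_ : 0 ≤ lam), Slam Ω f lam z)

/-- `f` is tame on `Ω` if `S f ≡ 0`. -/
def Tame {n : ℕ} (Ω : Set (Fin n → ℂ)) (f : (Fin n → ℂ) → EReal) : Prop :=
  ∀ z ∈ Ω, Sop Ω f z = 0

/-- `E` is a pluripolar subset of `Ω`: `E ⊆ {w = -∞}` for some plurisubharmonic `w` on `Ω`. -/
def Pluripolar {n : ℕ} (Ω : Set (Fin n → ℂ)) (E : Set (Fin n → ℂ)) : Prop :=
  E ⊆ Ω ∧ ∃ w, IsPSH Ω w ∧ ∀ z ∈ E, w z = ⊥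

open MeasureTheory

section SuperMean

open AddCircle

/-- An `ℝ≥0∞`-valued lower semicontinuous function on a compact metrizable space is controlled in
integral by its nonnegative continuous minorants. -/
theorem LowerSemicontinuous.lintegral_le_of_forall_continuous {X : Type*} [TopologicalSpace X]
    [NormalSpace X] [T1Space X] [HereditarilyLindelofSpace X] [MeasurableSpace X] [BorelSpace X]
    {μ : Measure X} {g : X → ENNReal} (hg : LowerSemicontinuous g) {M : ENNReal}
    (h : ∀ f : X → ℝ, Continuous f → (∀ x, 0 ≤ f x) → (∀ x, ENNReal.ofReal (f x) ≤ g x) →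
      ∫⁻ x, ENNReal.ofReal (f x) ∂μ ≤ M) :
    ∫⁻ x, g x ∂μ ≤ M := by
  let F : Set (X → ENNReal) := {k | ∃ f : X → ℝ, Continuous f ∧ (∀ x, 0 ≤ f x) ∧
    (k = fun x => ENNReal.ofReal (f x)) ∧ k ≤ g}
  have hsup : ∀ k₁ ∈ F, ∀ k₂ ∈ F, k₁ ⊔ k₂ ∈ F := by
    rintro _ ⟨f₁, hc₁, h₁, rfl, hg₁⟩ _ ⟨f₂, hc₂, h₂, rfl, hg₂⟩
    refine ⟨fun x => max (f₁ x) (f₂ x), hc₁.max hc₂, fun x => (h₁ x).trans (le_max_left _ _),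
      ?_, sup_le hg₁ hg₂⟩
    ext x
    exact (ENNReal.ofReal_max _ _).symm
  have hlub : IsLUB F g := by
    refine ⟨fun k hk => hk.choose_spec.2.2.2, fun b hb x => le_of_forall_lt fun a ha => ?_⟩
    obtain ⟨a', haa', ha'⟩ := exists_between ha
    obtain ⟨φ, hφ0, hφ1, hφ⟩ := exists_continuous_zero_one_of_isClosed
      (s := {y | a' < g y}ᶜ) (t := {x}) (hg.isOpen_preimage a').isClosed_compl isClosed_singleton
      (by simpa using ha')
    have ha'top : a' ≠ ⊤ := ha'.ne_top
    have hk : (fun y => ENNReal.ofReal (a'.toReal * φ y)) ∈ F := by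
      refine ⟨fun y => a'.toReal * φ y, by fun_prop,
        fun y => mul_nonneg ENNReal.toReal_nonneg (hφ y).1, rfl, fun y => ?_⟩
      by_cases hy : a' < g y
      · refine le_trans ?_ hy.le
        rw [← ENNReal.ofReal_toReal ha'top]
        refine ENNReal.ofReal_le_ofReal ?_
        rw [ENNReal.ofReal_toReal ha'top]
        exact mul_le_of_le_one_right ENNReal.toReal_nonneg (hφ y).2
      · have : φ y = 0 := hφ0 hy
        simp [this]
    have h1 : φ x = 1 := hφ1 rfl
    have := hb hk x
    simp only [h1, mul_one, ENNReal.ofReal_toReal ha'top] at this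
    exact haa'.trans_le this
  obtain ⟨F', hF'F, hF'c, hF'⟩ := exists_countable_lowerSemicontinuous_isLUB (𝓕 := F) (s := g)
    (by
      rintro _ ⟨f, hc, -, rfl, -⟩
      exact (ENNReal.continuous_ofReal.comp hc).lowerSemicontinuous) hlub
  have h0 : (0 : X → ENNReal) ∈ F := ⟨0, continuous_const, fun _ => le_rfl, by ext; simp,
    fun _ => zero_le⟩
  obtain ⟨k, hk⟩ := (hF'c.insert 0).exists_eq_range (insert_nonempty _ _)
  have hkF : ∀ n, k n ∈ F := fun n => by
    have : k n ∈ insert 0 F' := hk ▸ mem_range_self n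
    rcases this with h | h
    · exact h ▸ h0
    · exact hF'F h
  have hpF : ∀ n, partialSups k n ∈ F := by
    intro n
    induction n with
    | zero => simpa using hkF 0
    | succ n ih => rw [partialSups_add_one]; exact hsup _ ih _ (hkF _)
  have hgk : g ≤ ⨆ n, partialSups k n := by
    rw [iSup_partialSups_eq]
    refine hF'.2 fun f hf => ?_
    have : f ∈ range k := hk ▸ mem_insert_of_mem _ hf
    obtain ⟨n, rfl⟩ := this
    exact le_iSup k n
  calc ∫⁻ x, g x ∂μ ≤ ∫⁻ x, ⨆ n, partialSups k n x ∂μ :=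
        lintegral_mono fun x => by simpa using hgk x
    _ = ⨆ n, ∫⁻ x, partialSups k n x ∂μ := by
        refine lintegral_iSup (fun n => ?_) (partialSups k).monotone
        obtain ⟨f, hc, -, hf, -⟩ := hpF n
        rw [hf]
        exact (ENNReal.continuous_ofReal.comp hc).measurable
    _ ≤ M := by
        refine iSup_le fun n => ?_
        obtain ⟨f, hc, hn, hf, hfg⟩ := hpF n
        rw [hf]
        exact h f hc hn fun x => by simpa [hf] using hfg x

theorem fourier_natCast_apply (k : ℕ) (t : UnitAddCircle) :
    fourier (k : ℤ) t = (toCircle t : ℂ) ^ k := by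
  rw [fourier_apply, AddCircle.toCircle_zsmul, zpow_natCast, Circle.coe_pow]

/-- The boundary values of real parts of polynomials are dense among continuous functions on the
unit circle. -/
theorem exists_polynomial_re_near (f : UnitAddCircle → ℝ) (hf : Continuous f) {ε : ℝ}
    (hε : 0 < ε) :
    ∃ p : ℂ[X], ∀ t : UnitAddCircle, |(p.eval (toCircle t : ℂ)).re - f t| < ε := by
  let F : C(UnitAddCircle, ℂ) := ⟨fun t => (f t : ℂ), by fun_prop⟩
  have hF : F ∈ closure (Submodule.span ℂ (range (@fourier 1)) : Set C(UnitAddCircle, ℂ)) := by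
    rw [← Submodule.topologicalClosure_coe, span_fourier_closure_eq_top]
    trivial
  obtain ⟨q, hq, hqF⟩ := Metric.mem_closure_iff.1 hF ε hε
  have key : ∀ c : ℂ, ∃ p : ℂ[X], ∀ t : UnitAddCircle,
      (p.eval (toCircle t : ℂ)).re = (c * q t).re := by
    refine Submodule.span_induction (p := fun q _ => ∀ c : ℂ, ∃ p : ℂ[X], ∀ t : UnitAddCircle,
      (p.eval (toCircle t : ℂ)).re = (c * q t).re) ?_ ?_ ?_ ?_ hq
    · rintro _ ⟨m, rfl⟩ c
      obtain ⟨k, rfl | rfl⟩ := m.eq_nat_or_neg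
      · refine ⟨Polynomial.C c * Polynomial.X ^ k, fun t => ?_⟩
        rw [fourier_natCast_apply]
        simp
      · refine ⟨Polynomial.C (starRingEnd ℂ c) * Polynomial.X ^ k, fun t => ?_⟩
        rw [fourier_neg, fourier_natCast_apply, ← Complex.conj_re]
        simp
    · exact fun c => ⟨0, fun t => by simp⟩
    · intro x y _ _ hx hy c
      obtain ⟨p₁, h₁⟩ := hx c
      obtain ⟨p₂, h₂⟩ := hy c
      exact ⟨p₁ + p₂, fun t => by simp [mul_add, h₁ t, h₂ t]⟩
    · intro a x _ hx c
      obtain ⟨p, hp⟩ := hx (c * a)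
      exact ⟨p, fun t => by simp [hp t, mul_assoc]⟩
  obtain ⟨p, hp⟩ := key 1
  refine ⟨p, fun t => ?_⟩
  have h1 : dist (F t) (q t) < ε := (ContinuousMap.dist_apply_le_dist t).trans_lt hqF
  rw [dist_comm, Complex.dist_eq] at h1
  rw [hp t, one_mul]
  calc |(q t).re - f t| = |(q t - F t).re| := by simp [F]
    _ ≤ ‖q t - F t‖ := Complex.abs_re_le_norm _
    _ < ε := h1

theorem continuous_polynomial_toCircle_re (p : ℂ[X]) :
    Continuous fun t : UnitAddCircle => (p.eval (toCircle t : ℂ)).re :=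
  Complex.continuous_re.comp (p.continuous.comp
    (continuous_subtype_val.comp AddCircle.continuous_toCircle))

theorem integrable_of_continuous_addCircle {E : Type*} [NormedAddCommGroup E]
    {f : UnitAddCircle → E} (hf : Continuous f) :
    Integrable f (haarAddCircle : Measure UnitAddCircle) :=
  hf.integrable_of_hasCompactSupport (HasCompactSupport.of_compactSpace f)

/-- The mean value property for real parts of polynomials on the unit circle. -/
theorem integral_polynomial_toCircle_re (p : ℂ[X]) :
    ∫ t : UnitAddCircle, (p.eval (toCircle t : ℂ)).re ∂haarAddCircle = (p.eval 0).re := by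
  have hc : ∀ p : ℂ[X], Integrable (fun t : UnitAddCircle => p.eval (toCircle t : ℂ))
      haarAddCircle := fun p => integrable_of_continuous_addCircle
    (p.continuous.comp (continuous_subtype_val.comp AddCircle.continuous_toCircle))
  have key : ∫ t : UnitAddCircle, p.eval (toCircle t : ℂ) ∂haarAddCircle = p.eval 0 := by
    induction p using Polynomial.induction_on' with
    | add p q hp hq =>
      simp only [Polynomial.eval_add]
      rw [integral_add (hc p) (hc q), hp, hq]
    | monomial k c =>
      have h := congrFun (fourierCoeff_fourier (T := 1) (k : ℤ)) 0
      simp only [fourierCoeff, neg_zero, fourier_zero, one_smul, fourier_natCast_apply] at h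
      simp only [Polynomial.eval_monomial]
      rw [integral_const_mul, h]
      rcases Nat.eq_zero_or_pos k with rfl | hk
      · simp
      · simp [hk.ne']
  rw [← key]
  exact integral_re (hc p)

/-- A lower semicontinuous `ℝ≥0∞`-valued function whose mean over the boundary of every closed
disc in `Ω` is at most its value at the centre. -/
structure HasSuperMean {n : ℕ} (Ω : Set (Fin n → ℂ)) (V : (Fin n → ℂ) → ENNReal) : Prop where
  lsc : LowerSemicontinuous V
  mean_le : ∀ z w : Fin n → ℂ, (∀ ζ : ℂ, ‖ζ‖ ≤ 1 → z + ζ • w ∈ Ω) →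
    ∫⁻ t : UnitAddCircle, V (z + (toCircle t : ℂ) • w) ∂haarAddCircle ≤ V z

theorem continuous_add_toCircle_smul {n : ℕ} :
    Continuous fun x : (Fin n → ℂ) × (Fin n → ℂ) × UnitAddCircle =>
      x.1 + (toCircle x.2.2 : ℂ) • x.2.1 := by
  have : Continuous fun x : (Fin n → ℂ) × (Fin n → ℂ) × UnitAddCircle => (toCircle x.2.2 : ℂ) :=
    continuous_subtype_val.comp (AddCircle.continuous_toCircle.comp (by fun_prop))
  fun_prop

theorem HasSuperMean.tsum {n : ℕ} {Ω : Set (Fin n → ℂ)} {V : ℕ → (Fin n → ℂ) → ENNReal}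
    (hV : ∀ j, HasSuperMean Ω (V j)) : HasSuperMean Ω fun z => ∑' j, V j z where
  lsc := lowerSemicontinuous_tsum fun j => (hV j).lsc
  mean_le z w h := by
    rw [lintegral_tsum fun j => ?_]
    · exact ENNReal.tsum_le_tsum fun j => (hV j).mean_le z w h
    · exact ((hV j).lsc.measurable.comp (continuous_add_toCircle_smul.comp
        (by fun_prop : Continuous fun t : UnitAddCircle => (z, w, t))).measurable).aemeasurable

theorem exists_toCircle_eq {ζ : ℂ} (hζ : ‖ζ‖ = 1) : ∃ t : UnitAddCircle, (toCircle t : ℂ) = ζ := by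
  obtain ⟨t, ht⟩ := (AddCircle.homeomorphCircle (one_ne_zero (α := ℝ))).surjective
    ⟨ζ, mem_sphere_zero_iff_norm.2 hζ⟩
  refine ⟨t, ?_⟩
  rw [AddCircle.homeomorphCircle_apply] at ht
  rw [ht]

theorem IsPSupH.hasSuperMean {n : ℕ} {Ω : Set (Fin n → ℂ)} (hΩ : IsOpen Ω)
    {v : (Fin n → ℂ) → EReal} (hv : IsPSupH Ω v) (h0 : ∀ z ∈ Ω, 0 ≤ v z) :
    HasSuperMean Ω (Ω.indicator fun z => (v z).toENNReal) := by
  obtain ⟨husc, -, -, hmax⟩ := hv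
  have hlsc : LowerSemicontinuous (Ω.indicator fun z => (v z).toENNReal) := by
    intro z a ha
    have hz : z ∈ Ω := by
      by_contra hz
      simp [indicator_of_notMem hz] at ha
    rw [indicator_of_mem hz] at ha
    have ha' : (a : EReal) < v z := by
      rw [← EReal.coe_toENNReal (h0 z hz)]
      exact EReal.coe_ennreal_lt_coe_ennreal_iff.2 ha
    have := husc z hz (-(a : EReal)) (EReal.neg_lt_neg_iff.2 ha')
    rw [hΩ.nhdsWithin_eq hz] at this
    filter_upwards [this, hΩ.mem_nhds hz] with y hy hyΩ
    rw [gt_iff_lt, indicator_of_mem hyΩ, ← EReal.coe_ennreal_lt_coe_ennreal_iff,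
      EReal.coe_toENNReal (h0 y hyΩ)]
    exact EReal.neg_lt_neg_iff.1 hy
  refine ⟨hlsc, fun z w hzw => ?_⟩
  have hcirc : Continuous fun t : UnitAddCircle => z + (toCircle t : ℂ) • w :=
    continuous_add_toCircle_smul.comp
        (by fun_prop : Continuous fun t : UnitAddCircle => (z, w, t))
  have hz : z ∈ Ω := by simpa using hzw 0 (by simp)
  refine LowerSemicontinuous.lintegral_le_of_forall_continuous
    (g := fun t : UnitAddCircle => Ω.indicator (fun z => (v z).toENNReal) _)
    (hlsc.comp hcirc) fun f hf hfn hfg => ?_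
  rw [← ofReal_integral_eq_lintegral_ofReal (integrable_of_continuous_addCircle hf)
    (ae_of_all _ hfn)]
  refine ENNReal.le_of_forall_pos_le_add fun ε hε _ => ?_
  obtain ⟨p, hp⟩ := exists_polynomial_re_near f hf (half_pos (NNReal.coe_pos.2 hε))
  have hpint : ∫ t, f t ∂haarAddCircle - (ε : ℝ) / 2 ≤ (p.eval 0).re := by
    rw [← integral_polynomial_toCircle_re p]
    have : ∫ t, (f t - (ε : ℝ) / 2) ∂haarAddCircle ≤
        ∫ t : UnitAddCircle, (p.eval (toCircle t : ℂ)).re ∂haarAddCircle := by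
      refine integral_mono (integrable_of_continuous_addCircle (by fun_prop))
        (integrable_of_continuous_addCircle (continuous_polynomial_toCircle_re p)) fun t => ?_
      have := abs_lt.1 (hp t)
      simp only
      linarith
    rw [integral_sub (integrable_of_continuous_addCircle hf) (integrable_const _)] at this
    simpa using this
  have hbdry : ∀ ζ : ℂ, ‖ζ‖ = 1 →
      -(v (z + ζ • w)) ≤ ((((Polynomial.C ((ε / 2 : ℝ) : ℂ) - p).eval ζ).re : ℝ) : EReal) := by
    intro ζ hζ
    obtain ⟨t, rfl⟩ := exists_toCircle_eq hζ
    have hmem := hzw _ hζ.le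
    have h1 := hfg t
    rw [indicator_of_mem hmem, ← EReal.coe_ennreal_le_coe_ennreal_iff,
      EReal.coe_toENNReal (h0 _ hmem), EReal.coe_ennreal_ofReal, max_eq_left (hfn t)] at h1
    have h2 := abs_lt.1 (hp t)
    rw [EReal.neg_le]
    refine le_trans ?_ h1
    rw [← EReal.coe_neg, EReal.coe_le_coe_iff]
    simp only [Polynomial.eval_sub, Polynomial.eval_C, Complex.sub_re, Complex.ofReal_re]
    linarith
  have := hmax z hz w 1 one_pos hzw _ hbdry 0 (by simp)
  rw [zero_smul, add_zero, EReal.neg_le, ← EReal.coe_neg] at this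
  have hle : ENNReal.ofReal ((p.eval 0).re - ε / 2) ≤ (v z).toENNReal := by
    rw [← EReal.real_coe_toENNReal]
    refine EReal.toENNReal_le_toENNReal (le_trans ?_ this)
    simp
  rw [indicator_of_mem hz]
  calc ENNReal.ofReal (∫ t, f t ∂haarAddCircle)
      ≤ ENNReal.ofReal (((p.eval 0).re - ε / 2) + ε) :=
        ENNReal.ofReal_le_ofReal (by linarith)
    _ ≤ ENNReal.ofReal ((p.eval 0).re - ε / 2) + ENNReal.ofReal ε := ENNReal.ofReal_add_le
    _ ≤ (v z).toENNReal + ε := by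
        rw [ENNReal.ofReal_coe_nnreal]
        gcongr

theorem HasSuperMean.isPSupH {n : ℕ} {Ω : Set (Fin n → ℂ)} {V : (Fin n → ℂ) → ENNReal}
    (hV : HasSuperMean Ω V) (hfin : ∃ z ∈ Ω, V z ≠ ⊤) : IsPSupH Ω fun z => (V z : EReal) := by
  refine ⟨?_, fun z _ => ?_, ?_, ?_⟩
  · intro z hz a ha
    refine Filter.Eventually.filter_mono nhdsWithin_le_nhds ?_
    have ha' : -a < (V z : EReal) := EReal.neg_lt_comm.1 ha
    have : LowerSemicontinuous fun z => (V z : EReal) :=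
      continuous_coe_ennreal_ereal.comp_lowerSemicontinuous hV.lsc
        fun _ _ h => EReal.coe_ennreal_le_coe_ennreal_iff.2 h
    filter_upwards [this z _ ha'] with y hy
    exact EReal.neg_lt_comm.1 hy
  · simp
  · obtain ⟨z, hz, hzt⟩ := hfin
    exact ⟨z, hz, by simpa using hzt⟩
  intro z hz w r hr hdisc p hp
  by_contra! hcon
  obtain ⟨ζ₁, hζ₁, hlt⟩ := hcon
  have hcoe : ∀ c : ENNReal, c ≠ ⊤ → (c : EReal) = (c.toReal : EReal) := fun c hc => by
    rw [← EReal.coe_ennreal_toReal hc]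
  rw [← EReal.neg_lt_neg_iff, neg_neg, ← EReal.coe_neg] at hlt
  have hfin₁ : V (z + ζ₁ • w) ≠ ⊤ := by
    rintro h
    simp [h] at hlt
  rw [hcoe _ hfin₁, EReal.coe_lt_coe_iff] at hlt
  obtain ⟨ε, hε, hεr⟩ : ∃ ε : ℝ, 0 < ε ∧
      (V (z + ζ₁ • w)).toReal + (p.eval ζ₁).re + ε * r ^ 2 < 0 := by
    refine ⟨(-(p.eval ζ₁).re - (V (z + ζ₁ • w)).toReal) / (2 * r ^ 2),
      div_pos (by linarith) (by positivity), ?_⟩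
    field_simp
    linarith
  let k : ℂ → ℝ := fun ζ => (p.eval ζ).re + ε * (r ^ 2 - ‖ζ‖ ^ 2)
  have hk : Continuous k := by
    have := Complex.continuous_re.comp p.continuous
    simp only [Function.comp_def] at this
    fun_prop
  have hVlsc : LowerSemicontinuous fun ζ : ℂ => (V (z + ζ • w) : EReal) :=
    continuous_coe_ennreal_ereal.comp_lowerSemicontinuous
      (hV.lsc.comp (by fun_prop : Continuous fun ζ : ℂ => z + ζ • w))
      fun _ _ h => EReal.coe_ennreal_le_coe_ennreal_iff.2 h
  have hsum : LowerSemicontinuous fun ζ : ℂ => (V (z + ζ • w) : EReal) + (k ζ : EReal) :=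
    hVlsc.add' (continuous_coe_real_ereal.comp hk).lowerSemicontinuous
      fun ζ => EReal.continuousAt_add (by simp) (by simp)
  obtain ⟨ζ₀, hζ₀, hmin⟩ := LowerSemicontinuousOn.exists_isMinOn
    (s := Metric.closedBall (0 : ℂ) r) ⟨ζ₁, by simpa using hζ₁⟩ (isCompact_closedBall _ _)
    (hsum.lowerSemicontinuousOn _)
  have hk₁ : (V (z + ζ₁ • w)).toReal + k ζ₁ < 0 := by
    simp only [k]
    nlinarith [sq_nonneg ‖ζ₁‖]
  have hneg : (V (z + ζ₀ • w) : EReal) + (k ζ₀ : EReal) < 0 := by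
    refine lt_of_le_of_lt (hmin (by simpa using hζ₁ : ζ₁ ∈ Metric.closedBall (0 : ℂ) r)) ?_
    simp only
    rw [hcoe _ hfin₁, ← EReal.coe_add]
    exact_mod_cast hk₁
  have hfin₀ : V (z + ζ₀ • w) ≠ ⊤ := by
    rintro h
    simp [h] at hneg
  obtain ⟨V₀, hV₀⟩ : ∃ V₀ : ℝ, V₀ = (V (z + ζ₀ • w)).toReal := ⟨_, rfl⟩
  have hV₀nn : 0 ≤ V₀ := hV₀ ▸ ENNReal.toReal_nonneg
  rw [hcoe _ hfin₀, ← hV₀, ← EReal.coe_add, ← EReal.coe_zero, EReal.coe_lt_coe_iff] at hneg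
  rw [mem_closedBall_zero_iff] at hζ₀
  have hζ₀r : ‖ζ₀‖ < r := by
    refine lt_of_le_of_ne hζ₀ fun heq => ?_
    have := hp ζ₀ heq
    simp only at this
    rw [hcoe _ hfin₀, ← hV₀, ← EReal.coe_neg, EReal.coe_le_coe_iff] at this
    simp only [k, heq] at hneg
    linarith
  set ρ : ℝ := r - ‖ζ₀‖ with hρ
  have hρ0 : 0 < ρ := sub_pos.2 hζ₀r
  have hcenter : ∀ ζ : ℂ, z + ζ₀ • w + ζ • ((ρ : ℂ) • w) = z + (ζ₀ + ζ * ρ) • w := fun ζ => by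
    rw [smul_smul, add_smul, add_assoc]
  have hnorm : ∀ ζ : ℂ, ‖ζ‖ ≤ 1 → ‖ζ₀ + ζ * ρ‖ ≤ r := fun ζ hζ => by
    refine (norm_add_le _ _).trans ?_
    rw [norm_mul, Complex.norm_real, Real.norm_of_nonneg hρ0.le]
    nlinarith
  have hmean := hV.mean_le (z + ζ₀ • w) ((ρ : ℂ) • w) fun ζ hζ => by
    rw [hcenter]
    exact hdisc _ (hnorm ζ hζ)
  let P : ℂ[X] := Polynomial.C ((V₀ + k ζ₀ + ε * (‖ζ₀‖ ^ 2 + ρ ^ 2 - r ^ 2) : ℝ) : ℂ) -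
    p.comp (Polynomial.C ζ₀ + Polynomial.X * Polynomial.C (ρ : ℂ)) +
    Polynomial.C ((2 * ε * ρ : ℝ) * starRingEnd ℂ ζ₀) * Polynomial.X
  have hP : ∀ t : UnitAddCircle, ENNReal.ofReal ((P.eval (toCircle t : ℂ)).re) ≤
      V (z + ζ₀ • w + (toCircle t : ℂ) • ((ρ : ℂ) • w)) := by
    intro t
    have hc : ‖(toCircle t : ℂ)‖ = 1 := Circle.norm_coe _
    set c : ℂ := (toCircle t : ℂ)
    rw [hcenter]
    have hPre : (P.eval c).re = V₀ + k ζ₀ - k (ζ₀ + c * ρ) := by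
      have hsq : ‖ζ₀ + c * ρ‖ ^ 2 = ‖ζ₀‖ ^ 2 + ρ ^ 2 + 2 * ρ * (starRingEnd ℂ ζ₀ * c).re := by
        have h1 : c.re * c.re + c.im * c.im = 1 := by
          rw [← Complex.normSq_apply, Complex.normSq_eq_norm_sq, hc, one_pow]
        simp only [← Complex.normSq_eq_norm_sq, Complex.normSq_apply, Complex.add_re,
          Complex.add_im, Complex.mul_re, Complex.mul_im, Complex.ofReal_re, Complex.ofReal_im,
          Complex.conj_re, Complex.conj_im]
        linear_combination ρ ^ 2 * h1
      simp only [P, k, hsq, Polynomial.eval_add, Polynomial.eval_sub, Polynomial.eval_mul,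
        Polynomial.eval_C, Polynomial.eval_X, Polynomial.eval_comp, Complex.add_re, Complex.sub_re,
        mul_assoc (_ : ℂ), Complex.re_ofReal_mul, Complex.ofReal_re]
      ring
    have := hmin (by simpa using hnorm c hc.le : ζ₀ + c * ρ ∈ Metric.closedBall (0 : ℂ) r)
    simp only [mem_ofPred_eq] at this
    rcases eq_or_ne (V (z + (ζ₀ + c * ρ) • w)) ⊤ with htop | htop
    · simp [htop]
    rw [hcoe _ hfin₀, ← hV₀, hcoe _ htop, ← EReal.coe_add, ← EReal.coe_add,
      EReal.coe_le_coe_iff] at this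
    rw [hPre]
    refine ENNReal.ofReal_le_of_le_toReal (by linarith)
  have h_int : ENNReal.ofReal ((P.eval 0).re) ≤
      ∫⁻ t : UnitAddCircle, ENNReal.ofReal ((P.eval (toCircle t : ℂ)).re) ∂haarAddCircle := by
    rw [← integral_polynomial_toCircle_re P]
    refine ENNReal.ofReal_le_of_le_toReal ?_
    rw [integral_eq_lintegral_pos_part_sub_lintegral_neg_part
      (integrable_of_continuous_addCircle (continuous_polynomial_toCircle_re P))]
    exact sub_le_self _ ENNReal.toReal_nonneg
  have hP0 : (P.eval 0).re = V₀ + ε * ρ ^ 2 := by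
    simp only [P, k, Polynomial.eval_add, Polynomial.eval_sub, Polynomial.eval_mul,
      Polynomial.eval_C, Polynomial.eval_X, Polynomial.eval_comp, Complex.sub_re,
      Complex.ofReal_re, mul_zero, zero_mul, add_zero]
    ring
  have hfinal : ENNReal.ofReal (V₀ + ε * ρ ^ 2) ≤ ENNReal.ofReal V₀ := by
    rw [hV₀, ENNReal.ofReal_toReal hfin₀, ← hV₀, ← hP0]
    exact h_int.trans ((lintegral_mono hP).trans hmean)
  rw [ENNReal.ofReal_le_ofReal_iff hV₀nn] at hfinal
  have : 0 < ε * ρ ^ 2 := by positivity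
  linarith

theorem lintegral_circle_smul {n : ℕ} (c : Circle) {W : (Fin n → ℂ) → ENNReal}
    (hW : Measurable W) : ∫⁻ w, W ((c : ℂ) • w) = ∫⁻ w, W w := by
  have h : MeasurePreserving (fun (w : Fin n → ℂ) i => rotation c (w i)) volume volume :=
    volume_preserving_pi fun _ => (rotation c).measurePreserving
  exact h.lintegral_comp hW

/-- The mean value inequality over balls. -/
theorem HasSuperMean.setLIntegral_ball_le {n : ℕ} {Ω : Set (Fin n → ℂ)}
    {V : (Fin n → ℂ) → ENNReal} (hV : HasSuperMean Ω V) {z : Fin n → ℂ} {r : ℝ}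
    (hball : Metric.ball z r ⊆ Ω) :
    ∫⁻ w in Metric.ball z r, V w ≤ V z * volume (Metric.ball (0 : Fin n → ℂ) r) := by
  have hVm := hV.lsc.measurable
  let W : (Fin n → ℂ) → ENNReal := (Metric.ball 0 r).indicator fun w => V (z + w)
  have hW : Measurable W :=
    (hVm.comp (measurable_const_add z)).indicator measurableSet_ball
  have hrot : ∀ (t : UnitAddCircle) (w : Fin n → ℂ), W ((toCircle t : ℂ) • w) =
      (Metric.ball 0 r).indicator (fun w => V (z + (toCircle t : ℂ) • w)) w := by
    intro t w
    simp only [W, indicator, mem_ball_zero_iff, norm_smul, Circle.norm_coe, one_mul]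
  have hcont : Continuous fun x : UnitAddCircle × (Fin n → ℂ) => (toCircle x.1 : ℂ) • x.2 := by
    have : Continuous fun x : UnitAddCircle × (Fin n → ℂ) => (toCircle x.1 : ℂ) :=
      continuous_subtype_val.comp (AddCircle.continuous_toCircle.comp (by fun_prop))
    fun_prop
  calc ∫⁻ w in Metric.ball z r, V w
      = ∫⁻ w, (Metric.ball z r).indicator V w := (lintegral_indicator measurableSet_ball _).symm
    _ = ∫⁻ w, (Metric.ball z r).indicator V (z + w) := (lintegral_add_left_eq_self _ z).symm
    _ = ∫⁻ w, W w := by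
        refine lintegral_congr fun w => ?_
        simp [W, indicator, Metric.mem_ball, dist_eq_norm]
    _ = ∫⁻ _ : UnitAddCircle, ∫⁻ w, W w ∂volume ∂haarAddCircle := by simp
    _ = ∫⁻ t : UnitAddCircle, ∫⁻ w, W ((toCircle t : ℂ) • w) ∂volume ∂haarAddCircle :=
        lintegral_congr fun t => (lintegral_circle_smul _ hW).symm
    _ = ∫⁻ w, ∫⁻ t : UnitAddCircle, W ((toCircle t : ℂ) • w) ∂haarAddCircle ∂volume :=
        lintegral_lintegral_swap (hW.comp hcont.measurable).aemeasurable
    _ ≤ ∫⁻ w : Fin n → ℂ, (Metric.ball 0 r).indicator (fun _ => V z) w := by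
        refine lintegral_mono fun w => ?_
        by_cases hw : w ∈ Metric.ball (0 : Fin n → ℂ) r
        · simp only [hrot, indicator_of_mem hw]
          refine hV.mean_le z w fun ζ hζ => hball ?_
          rw [mem_ball_zero_iff] at hw
          rw [Metric.mem_ball, dist_eq_norm, add_sub_cancel_left, norm_smul]
          nlinarith [norm_nonneg w]
        · simp [hrot, indicator_of_notMem hw]
    _ = V z * volume (Metric.ball (0 : Fin n → ℂ) r) := by
        rw [lintegral_indicator measurableSet_ball, setLIntegral_const]

/-- For a tame function, the truncations at high levels have majorants with arbitrarily small
integral near any given point. -/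
theorem Tame.exists_hasSuperMean {n : ℕ} {Ω : Set (Fin n → ℂ)} (hΩ : IsOpen Ω)
    {f : (Fin n → ℂ) → EReal} (hf : Tame Ω f) {z : Fin n → ℂ} {r : ℝ} (hr : 0 < r)
    (hball : Metric.ball z (3 * r) ⊆ Ω) (L : ℝ) {ε : ENNReal} (hε : ε ≠ 0) :
    ∃ lam : ℝ, L ≤ lam ∧ 0 ≤ lam ∧ ∃ V, HasSuperMean Ω V ∧
      (∀ ζ ∈ Ω, (f ζ - (lam : EReal)).toENNReal ≤ V ζ) ∧ ∫⁻ w in Metric.ball z r, V w ≤ ε := by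
  have hz : z ∈ Ω := hball (Metric.mem_ball_self (by positivity))
  have hvol : volume (Metric.ball (0 : Fin n → ℂ) (2 * r)) ≠ ⊤ := measure_ball_lt_top.ne
  obtain ⟨δ, hδ0, hδ⟩ : ∃ δ : ENNReal, 0 < δ ∧
      δ * volume (Metric.ball (0 : Fin n → ℂ) (2 * r)) ≤ ε :=
    ⟨ε / volume (Metric.ball (0 : Fin n → ℂ) (2 * r)), ENNReal.div_pos hε hvol,
      (ENNReal.div_mul_cancel (Metric.measure_ball_pos _ _ (by positivity)).ne' hvol).le⟩
  have hδ0' : (0 : EReal) < δ := by exact_mod_cast hδ0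
  have hnear : ∀ᶠ y in 𝓝[Ω] z, y ∈ Metric.ball z r :=
    mem_nhdsWithin_of_mem_nhds (Metric.ball_mem_nhds z hr)
  have h1 : ∃ᶠ y in 𝓝[Ω] z, (⨅ (lam : ℝ) (_ : 0 ≤ lam), Slam Ω f lam y) < δ :=
    frequently_lt_of_liminf_lt (by isBoundedDefault)
      ((hf z hz).trans_lt hδ0' : liminf _ (𝓝[Ω] z) < (δ : EReal))
  obtain ⟨y, hy, hyr, hyΩ⟩ := (h1.and_eventually (hnear.and self_mem_nhdsWithin)).exists
  simp only [iInf_lt_iff] at hy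
  obtain ⟨lam, hlam0, hlam⟩ := hy
  have hnear' : ∀ᶠ x in 𝓝[Ω] y, x ∈ Metric.ball z r :=
    mem_nhdsWithin_of_mem_nhds (Metric.isOpen_ball.mem_nhds hyr)
  have h2 : ∃ᶠ x in 𝓝[Ω] y, Rop Ω f lam x < δ :=
    frequently_lt_of_liminf_lt (by isBoundedDefault) hlam
  obtain ⟨x, hx, hxr, hxΩ⟩ := (h2.and_eventually (hnear'.and self_mem_nhdsWithin)).exists
  obtain ⟨_, ⟨v, hv, hfv, rfl⟩, hvx⟩ := sInf_lt_iff.1 hx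
  have hv0 : ∀ ζ ∈ Ω, 0 ≤ v ζ := fun ζ hζ => (le_max_right _ _).trans (hfv ζ hζ)
  have hV := hv.hasSuperMean hΩ hv0
  refine ⟨max lam L, le_max_right _ _, hlam0.trans (le_max_left _ _), _, hV, fun ζ hζ => ?_, ?_⟩
  · rw [indicator_of_mem hζ]
    refine EReal.toENNReal_le_toENNReal (le_trans ?_ ((le_max_left _ _).trans (hfv ζ hζ)))
    exact EReal.sub_le_sub le_rfl (EReal.coe_le_coe_iff.2 (le_max_left _ _))
  · have hdist : dist x z < r := hxr
    have hsub : Metric.ball x (2 * r) ⊆ Ω :=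
      (Metric.ball_subset_ball' (by linarith)).trans hball
    calc _ ≤ ∫⁻ w in Metric.ball x (2 * r), Ω.indicator (fun z => (v z).toENNReal) w :=
          lintegral_mono_set (Metric.ball_subset_ball' (by rw [dist_comm]; linarith))
      _ ≤ _ := hV.setLIntegral_ball_le hsub
      _ ≤ δ * volume (Metric.ball (0 : Fin n → ℂ) (2 * r)) := by
          gcongr
          rw [indicator_of_mem hxΩ, ← EReal.coe_ennreal_le_coe_ennreal_iff,
            EReal.coe_toENNReal (hv0 x hxΩ)]
          exact hvx.le
      _ ≤ ε := hδ

theorem tsum_toENNReal_sub {lam : ℕ → ℝ} (hlam : ∀ j : ℕ, (j : ℝ) ≤ lam j) (t : ℝ) {N : ℕ}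
    (hN : t ≤ N) :
    ∑' j, ((t : EReal) - (lam j : EReal)).toENNReal =
      ENNReal.ofReal (∑ j ∈ Finset.range N, max (t - lam j) 0) := by
  rw [ENNReal.ofReal_sum_of_nonneg fun _ _ => le_max_right _ _, tsum_eq_sum (s := Finset.range N)]
  · refine Finset.sum_congr rfl fun j _ => ?_
    rw [← EReal.coe_sub, EReal.real_coe_toENNReal, ENNReal.ofReal_max, ENNReal.ofReal_zero,
      max_eq_left zero_le]
  · intro j hj
    have : (N : ℝ) ≤ j := by simpa using hj
    rw [← EReal.coe_sub, EReal.real_coe_toENNReal, ENNReal.ofReal_eq_zero]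
    linarith [hlam j]

theorem convexOn_sum_max_sub (lam : ℕ → ℝ) (N : ℕ) :
    ConvexOn ℝ univ fun t : ℝ => ∑ j ∈ Finset.range N, max (t - lam j) 0 := by
  induction N with
  | zero => simpa using convexOn_const (0 : ℝ) convex_univ
  | succ N ih =>
    simp only [Finset.sum_range_succ]
    refine ih.add (ConvexOn.sup ?_ (convexOn_const (0 : ℝ) convex_univ))
    refine ⟨convex_univ, fun x _ y _ a b _ _ hab => le_of_eq ?_⟩
    simp only [smul_eq_mul]
    linear_combination lam N * hab

/-- The sum of the hinge functions `(t - λ_j)⁺` is convex and superlinear when `j ≤ λ_j`. -/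
theorem exists_convex_superlinear {lam : ℕ → ℝ} (hlam : ∀ j : ℕ, (j : ℝ) ≤ lam j) :
    ∃ φ₀ : ℝ → ℝ, ConvexOn ℝ univ φ₀ ∧ Tendsto (fun t => φ₀ t / t) atTop atTop ∧
      ∀ t : ℝ, ((∑' j, ((t : EReal) - (lam j : EReal)).toENNReal : ENNReal) : EReal) = φ₀ t := by
  let φ₀ : ℝ → ℝ := fun t => (∑' j, ((t : EReal) - (lam j : EReal)).toENNReal).toReal
  have hφ₀ : ∀ (t : ℝ) (N : ℕ), t ≤ N → φ₀ t = ∑ j ∈ Finset.range N, max (t - lam j) 0 :=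
    fun t N hN => by
      simp only [φ₀]
      rw [tsum_toENNReal_sub hlam t hN, ENNReal.toReal_ofReal]
      exact Finset.sum_nonneg fun _ _ => le_max_right _ _
  refine ⟨φ₀, ⟨convex_univ, fun x _ y _ a b ha hb hab => ?_⟩, ?_, fun t => ?_⟩
  · obtain ⟨N, hN⟩ := exists_nat_ge (max x y)
    have hx := (le_max_left x y).trans hN
    have hy := (le_max_right x y).trans hN
    have hxy : a • x + b • y ≤ N := by
      simp only [smul_eq_mul]
      nlinarith [mul_le_mul_of_nonneg_left hx ha, mul_le_mul_of_nonneg_left hy hb]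
    rw [hφ₀ x N hx, hφ₀ y N hy, hφ₀ _ N hxy]
    exact (convexOn_sum_max_sub lam N).2 (mem_univ x) (mem_univ y) ha hb hab
  · refine tendsto_atTop.2 fun K => ?_
    obtain ⟨N, hN⟩ := exists_nat_ge (max K 0 + 1)
    filter_upwards [eventually_gt_atTop (0 : ℝ),
      eventually_ge_atTop (∑ j ∈ Finset.range N, lam j)] with t ht ht'
    obtain ⟨M, hM⟩ := exists_nat_ge (max t N)
    have hNM : N ≤ M := by exact_mod_cast (le_max_right _ _).trans hM
    rw [le_div_iff₀ ht, hφ₀ t M ((le_max_left _ _).trans hM)]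
    have h1 : ∑ j ∈ Finset.range N, (t - lam j) ≤ ∑ j ∈ Finset.range M, max (t - lam j) 0 :=
      (Finset.sum_le_sum fun _ _ => le_max_left _ _).trans
        (Finset.sum_le_sum_of_subset_of_nonneg (Finset.range_mono hNM)
          fun _ _ _ => le_max_right _ _)
    rw [Finset.sum_sub_distrib] at h1
    simp only [Finset.sum_const, Finset.card_range, nsmul_eq_mul] at h1
    have hK : K ≤ N - 1 := by linarith [le_max_left K 0]
    nlinarith
  · obtain ⟨N, hN⟩ := exists_nat_ge t
    refine (EReal.coe_ennreal_toReal ?_).symm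
    rw [tsum_toENNReal_sub hlam t hN]
    exact ENNReal.ofReal_ne_top

end SuperMean

/-- Theorem 3.2, converse part: let `Ω ⊆ ℂⁿ` be a bounded domain and
let `u` be a function on `Ω` with `u⁺ = max {u, 0} ∈ ℳ`. If `u⁺` is tame, then there is an
increasing convex function `φ : [-∞, +∞] → [0, +∞]` (convex in the sense that it agrees on
`ℝ` with a convex real-valued function) with `liminf_{t→+∞} φ(t)/t = +∞`, such that
`φ ∘ u` admits a plurisuperharmonic majorant on `Ω`. -/
theorem statement7 {n : ℕ} (Ω : Set (Fin n → ℂ))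
    (hΩo : IsOpen Ω) (hΩc : IsConnected Ω) (hΩb : Bornology.IsBounded Ω)
    (u : (Fin n → ℂ) → EReal)
    (huM : MemM Ω (fun z => max (u z) 0))
    (htame : Tame Ω (fun z => max (u z) 0)) :
    ∃ φ : EReal → EReal, Monotone φ ∧ (∀ t, 0 ≤ φ t) ∧
      (∃ φ₀ : ℝ → ℝ, ConvexOn ℝ Set.univ φ₀ ∧ ∀ t : ℝ, φ (t : EReal) = ((φ₀ t : ℝ) : EReal)) ∧
      liminf (fun t : ℝ => φ (t : EReal) / (t : EReal)) atTop = (⊤ : EReal) ∧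
      ∃ v, IsPSupH Ω v ∧ ∀ z ∈ Ω, φ (u z) ≤ v z := by
  obtain ⟨z, hz⟩ := hΩc.nonempty
  obtain ⟨R, hR, hball⟩ := Metric.isOpen_iff.1 hΩo z hz
  have hr : 0 < R / 3 := by positivity
  have hball' : Metric.ball z (3 * (R / 3)) ⊆ Ω := by rwa [mul_div_cancel₀ _ three_ne_zero]
  choose lam hlam hlam0 V hV hfV hVint using fun j : ℕ =>
    htame.exists_hasSuperMean hΩo hr hball' j (ε := (2⁻¹ : ENNReal) ^ j) (by simp)
  have hsum := HasSuperMean.tsum hV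
  obtain ⟨φ₀, hconv, hsuper, hφ₀⟩ := exists_convex_superlinear hlam
  refine ⟨fun t => ((∑' j, (t - (lam j : EReal)).toENNReal : ENNReal) : EReal), fun s t hst => ?_,
    fun t => EReal.coe_ennreal_nonneg _, ⟨φ₀, hconv, hφ₀⟩, ?_, _, hsum.isPSupH ?_, fun ζ hζ => ?_⟩
  · exact EReal.coe_ennreal_le_coe_ennreal_iff.2 (ENNReal.tsum_le_tsum fun j =>
      EReal.toENNReal_le_toENNReal (EReal.sub_le_sub hst le_rfl))
  · simp only [hφ₀, ← EReal.coe_div]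
    exact (EReal.tendsto_coe_nhds_top_iff.2 hsuper).liminf_eq
  · have hfin : ∫⁻ w in Metric.ball z (R / 3), ∑' j, V j w ≠ ⊤ := by
      rw [lintegral_tsum fun j => (hV j).lsc.measurable.aemeasurable]
      refine ne_top_of_le_ne_top ?_ (ENNReal.tsum_le_tsum hVint)
      rw [ENNReal.tsum_geometric]
      simp
    have hae := ae_lt_top hsum.lsc.measurable hfin
    have : (ae (volume.restrict (Metric.ball z (R / 3)))).NeBot := by
      rw [ae_neBot, Ne, Measure.restrict_eq_zero]
      exact (Metric.measure_ball_pos _ _ hr).ne'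
    obtain ⟨x, hx, hxb⟩ := (hae.and (ae_restrict_mem measurableSet_ball)).exists
    exact ⟨x, hball (Metric.ball_subset_ball (by linarith) hxb), hx.ne⟩
  · refine EReal.coe_ennreal_le_coe_ennreal_iff.2 (ENNReal.tsum_le_tsum fun j => ?_)
    exact (EReal.toENNReal_le_toENNReal (EReal.sub_le_sub (le_max_left _ _) le_rfl)).trans
      (hfV j ζ hζ)
end
end

section
/- Let Ω ⊆ ℂⁿ be a bounded B-regular domain and let φ be a lower bounded, tame, plurisuperharmonic function on Ω with φ* = φ_* on the closure of Ω. Then the Perron–Bremermann envelope Pφ(z) = sup{u(z) : u plurisubharmonic on Ω, u* ≤ φ_* on cl(Ω)} attains the boundary values of φ: for every z₀ ∈ ∂Ω, lim_{Ω ∋ ζ → z₀} Pφ(ζ) = φ(z₀), the limit taken in [-∞, +∞] (φ(z₀) = +∞ is allowed). -/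
open Complex Polynomial Filter Set Topology

noncomputable section

/-- `Ω` is B-regular: every continuous real-valued function on `∂Ω` is the boundary value
of a function plurisubharmonic on `Ω` and continuous on `cl(Ω)`. -/
def BRegular {n : ℕ} (Ω : Set (Fin n → ℂ)) : Prop :=
  ∀ f : (Fin n → ℂ) → ℝ, ContinuousOn f (frontier Ω) →
    ∃ u : (Fin n → ℂ) → ℝ, IsPSH Ω (fun z => ((u z : ℝ) : EReal)) ∧
      ContinuousOn u (closure Ω) ∧ ∀ z ∈ frontier Ω, u z = f z

/-- A plurisubharmonic `u` on `Ω` is maximal: for every open `Ω'` compactly contained in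
`Ω` and every plurisubharmonic `v` on `Ω` with `v ≤ u` on `Ω ∖ Ω'`, one has `v ≤ u` on `Ω`. -/
def MaximalPSH {n : ℕ} (Ω : Set (Fin n → ℂ)) (u : (Fin n → ℂ) → EReal) : Prop :=
  IsPSH Ω u ∧
  ∀ Ω' : Set (Fin n → ℂ), IsOpen Ω' → Bornology.IsBounded Ω' → closure Ω' ⊆ Ω →
    ∀ v, IsPSH Ω v → (∀ z ∈ Ω \ Ω', v z ≤ u z) → ∀ z ∈ Ω, v z ≤ u z

/-- The Perron–Bremermann envelope of the boundary data `φ`: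
`Pφ(z) = sup { u(z) : u plurisubharmonic on Ω, u* ≤ φ_* on cl(Ω) }`. -/
def Perron {n : ℕ} (Ω : Set (Fin n → ℂ)) (φ : (Fin n → ℂ) → EReal)
    (z : Fin n → ℂ) : EReal :=
  sSup { y | ∃ u, IsPSH Ω u ∧ (∀ ξ ∈ closure Ω, uscReg Ω u ξ ≤ lscReg Ω φ ξ) ∧ y = u z }

/-- Complex multiples of elements of the span of the Fourier monomials have the same real part
as a polynomial on the unit circle. -/
lemma exists_polynomial_re_eq_of_mem_span_fourier {g : C(AddCircle (2 * Real.pi), ℂ)}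
    (hg : g ∈ Submodule.span ℂ (range (fourier (T := 2 * Real.pi)))) :
    ∀ c : ℂ, ∃ p : Polynomial ℂ, ∀ θ : AddCircle (2 * Real.pi),
      (c * g θ).re = (p.eval (AddCircle.toCircle θ : ℂ)).re := by
  induction hg using Submodule.span_induction with
  | mem x hx =>
    obtain ⟨k, rfl⟩ := hx
    intro c
    rcases Int.eq_nat_or_neg k with ⟨m, rfl | rfl⟩
    · refine ⟨Polynomial.C c * Polynomial.X ^ m, fun θ => ?_⟩
      simp [fourier_apply, AddCircle.toCircle_nsmul]
    · refine ⟨Polynomial.C ((starRingEnd ℂ) c) * Polynomial.X ^ m, fun θ => ?_⟩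
      rw [fourier_neg, ← Complex.conj_re]
      simp [fourier_apply, AddCircle.toCircle_nsmul]
  | zero => exact fun c => ⟨0, fun θ => by simp⟩
  | add x y _ _ hx hy =>
    intro c
    obtain ⟨p, hp⟩ := hx c
    obtain ⟨q, hq⟩ := hy c
    exact ⟨p + q, fun θ => by simp [mul_add, ← hp, ← hq]⟩
  | smul a x _ hx =>
    intro c
    obtain ⟨p, hp⟩ := hx (c * a)
    exact ⟨p, fun θ => by simp [← hp, mul_assoc]⟩

/-- Continuous real functions on the unit circle are uniform limits of real parts of
complex polynomials. -/
lemma exists_polynomial_re_near_on_unit_circle {f : ℂ → ℝ}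
    (hf : ContinuousOn f (Metric.sphere 0 1)) {δ : ℝ} (hδ : 0 < δ) :
    ∃ p : Polynomial ℂ, ∀ ζ : ℂ, ‖ζ‖ = 1 → |f ζ - (p.eval ζ).re| < δ := by
  have : Fact (0 < 2 * Real.pi) := ⟨Real.two_pi_pos⟩
  let F : C(AddCircle (2 * Real.pi), ℂ) :=
    ⟨fun θ => (f (AddCircle.toCircle θ : ℂ) : ℂ), by
      refine Complex.continuous_ofReal.comp (hf.comp_continuous ?_ fun θ => by
        simpa using Circle.norm_coe (AddCircle.toCircle θ))
      exact continuous_subtype_val.comp AddCircle.continuous_toCircle⟩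
  have hF : F ∈ (Submodule.span ℂ (range (fourier (T := 2 * Real.pi)))).topologicalClosure := by
    rw [span_fourier_closure_eq_top]
    trivial
  obtain ⟨g, hg, hFg⟩ := Metric.mem_closure_iff.1 hF δ hδ
  obtain ⟨p, hp⟩ := exists_polynomial_re_eq_of_mem_span_fourier hg 1
  refine ⟨p, fun ζ hζ => ?_⟩
  obtain ⟨θ, hθ'⟩ : ∃ θ : AddCircle (2 * Real.pi), (AddCircle.toCircle θ : ℂ) = ζ := by
    refine ⟨(Complex.arg ζ : ℝ), ?_⟩
    have := Complex.norm_mul_exp_arg_mul_I ζ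
    rw [hζ, Complex.ofReal_one, one_mul] at this
    rw [AddCircle.toCircle_apply_mk, Circle.coe_exp, div_self Real.two_pi_pos.ne', one_mul, this]
  have hdist : ‖F θ - g θ‖ < δ := by
    rw [← dist_eq_norm]
    exact (ContinuousMap.dist_apply_le_dist θ).trans_lt hFg
  have hre : (F θ - g θ).re = f ζ - (p.eval ζ).re := by
    have := hp θ
    rw [one_mul, hθ'] at this
    rw [Complex.sub_re, this]
    simp [F, hθ']
  rw [← hre]
  exact (Complex.abs_re_le_norm _).trans_lt hdist

/-- A real-valued continuous psh function minus a plurisuperharmonic function, perturbed by a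
strictly subharmonic quadratic term in one coordinate, has no interior maximum. -/
lemma not_isMinOn_psupH_sub_psh {n : ℕ} {Ω : Set (Fin n → ℂ)} (hΩ : IsOpen Ω)
    {u : (Fin n → ℂ) → ℝ} (hu : IsPSH Ω (fun z => ((u z : ℝ) : EReal))) (huc : ContinuousOn u Ω)
    {φ : (Fin n → ℂ) → EReal} (hφ : IsPSupH Ω φ) (i : Fin n) {ε : ℝ} (hε : 0 < ε)
    {a : Fin n → ℂ} (ha : a ∈ Ω) {A : ℝ} (hA : φ a = A)
    (hmin : ∀ z ∈ Ω,
      ((A - (u a + ε * ‖a i‖ ^ 2) + (u z + ε * ‖z i‖ ^ 2) : ℝ) : EReal) ≤ φ z) : False := by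
  obtain ⟨r, hr, hball⟩ := Metric.isOpen_iff.1 hΩ a ha
  set s : ℝ := r / 2 with hs
  have hs0 : 0 < s := by positivity
  set w : Fin n → ℂ := Pi.single i (s : ℂ) with hw
  have hdisc : ∀ ζ : ℂ, ‖ζ‖ ≤ 1 → a + ζ • w ∈ Ω := by
    intro ζ hζ
    apply hball
    rw [Metric.mem_ball, dist_eq_norm, add_sub_cancel_left, norm_smul, hw, Pi.norm_single,
      Complex.norm_real, Real.norm_of_nonneg hs0.le]
    nlinarith
  have hcirc : ContinuousOn (fun ζ : ℂ => u (a + ζ • w)) (Metric.sphere 0 1) := by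
    refine huc.comp (by fun_prop) fun ζ hζ => hdisc ζ ?_
    simpa using (mem_sphere_zero_iff_norm.1 hζ).le
  have hδ : 0 < ε * s ^ 2 / 4 := by positivity
  obtain ⟨p, hp⟩ := exists_polynomial_re_near_on_unit_circle hcirc hδ
  set δ : ℝ := ε * s ^ 2 / 4 with hδdef
  have hua := hu.2.2.2 a ha w 1 one_pos hdisc (p + Polynomial.C (δ : ℂ))
    (fun ζ hζ => by
      have := (abs_lt.1 (hp ζ hζ)).2
      simp only [Polynomial.eval_add, Polynomial.eval_C, Complex.add_re, Complex.ofReal_re]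
      exact_mod_cast (by linarith)) 0 (by simp)
  have hφa := hφ.2.2.2 a ha w 1 one_pos hdisc
    (Polynomial.C ((-(A - (u a + ε * ‖a i‖ ^ 2)) + δ - ε * ‖a i‖ ^ 2 - ε * s ^ 2 : ℝ) : ℂ) - p
      - Polynomial.C ((2 * ε * s : ℝ) * (starRingEnd ℂ) (a i)) * Polynomial.X)
    (fun ζ hζ => by
      have h1 := (abs_lt.1 (hp ζ hζ)).1
      have h2 := hmin _ (hdisc ζ hζ.le)
      have hsq : ‖(a + ζ • w) i‖ ^ 2
          = ‖a i‖ ^ 2 + s ^ 2 + 2 * s * ((starRingEnd ℂ) (a i) * ζ).re := by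
        have h3 : ζ.re ^ 2 + ζ.im ^ 2 = 1 := by
          have := Complex.sq_norm ζ
          rw [hζ, Complex.normSq_apply] at this
          linarith
        rw [Complex.sq_norm, Complex.sq_norm, Complex.normSq_apply, Complex.normSq_apply]
        simp [hw]
        linear_combination s ^ 2 * h3
      refine (EReal.neg_le_neg_iff.2 h2).trans ?_
      rw [hsq, ← EReal.coe_neg, EReal.coe_le_coe_iff]
      simp only [Polynomial.eval_sub, Polynomial.eval_mul, Polynomial.eval_C, Polynomial.eval_X,
        Complex.sub_re, Complex.ofReal_re, mul_assoc, Complex.re_ofReal_mul]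
      linarith) 0 (by simp)
  simp only [zero_smul, add_zero, hA, ← EReal.coe_neg, EReal.coe_le_coe_iff, Polynomial.eval_sub,
    Polynomial.eval_mul, Polynomial.eval_add, Polynomial.eval_C, Polynomial.eval_X, mul_zero,
    Complex.sub_re, Complex.add_re, Complex.ofReal_re, Complex.zero_re] at hua hφa
  have : 0 < ε * s ^ 2 := by positivity
  linarith

/-- Comparison principle: a psh function continuous on the closure which lies below the lower
boundary values of a plurisuperharmonic function lies below it in the domain. -/
lemma psh_le_psupH_of_frontier_le {n : ℕ} {Ω : Set (Fin n → ℂ)} (hΩ : IsOpen Ω)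
    (hΩb : Bornology.IsBounded Ω) (i : Fin n)
    {u : (Fin n → ℂ) → ℝ} (hu : IsPSH Ω (fun z => ((u z : ℝ) : EReal)))
    (huc : ContinuousOn u (closure Ω)) {φ : (Fin n → ℂ) → EReal} (hφ : IsPSupH Ω φ)
    (hle : ∀ ξ ∈ frontier Ω, (u ξ : EReal) ≤ lscReg Ω φ ξ) :
    ∀ z ∈ Ω, (u z : EReal) ≤ φ z := by
  intro z₁ hz₁
  by_contra! hlt
  have hbot : ∀ z ∈ Ω, φ z ≠ ⊥ := fun z hz h => hφ.2.1 z hz (by simp [h])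
  have hlsc : LowerSemicontinuousOn φ Ω := by
    intro z hz y hy
    filter_upwards [hφ.1 z hz (-y) (EReal.neg_lt_neg_iff.2 hy)] with x hx
    exact EReal.neg_lt_neg_iff.1 hx
  lift φ z₁ to ℝ using ⟨hlt.ne_top, hbot z₁ hz₁⟩ with A₁ hA₁
  rw [EReal.coe_lt_coe_iff] at hlt
  obtain ⟨B, hB⟩ := hΩb.closure.exists_norm_le
  set d := u z₁ - A₁ with hd
  have hd0 : 0 < d := by linarith
  set ε := d / (2 * (B ^ 2 + 1)) with hε
  have hε0 : 0 < ε := by positivity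
  have hεB : ∀ z ∈ closure Ω, ε * ‖z i‖ ^ 2 ≤ d / 2 := by
    intro z hz
    have h1 : ‖z i‖ ^ 2 ≤ B ^ 2 := by
      have := (norm_le_pi_norm z i).trans (hB z hz)
      gcongr
    calc ε * ‖z i‖ ^ 2 ≤ ε * (B ^ 2 + 1) := by gcongr; linarith
      _ = d / 2 := by rw [hε]; field_simp
  set g : (Fin n → ℂ) → ℝ := fun z => u z + ε * ‖z i‖ ^ 2 with hg
  have hgc : ContinuousOn g (closure Ω) := huc.add (by fun_prop)
  have key : ∀ ξ ∈ closure Ω, ∀ L : EReal, (∀ y < L, ∀ᶠ z in 𝓝[Ω] ξ, y < φ z) →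
      ∀ y < L + ((-g ξ : ℝ) : EReal), ∀ᶠ z in 𝓝[Ω] ξ, y < φ z + ((-g z : ℝ) : EReal) := by
    intro ξ hξ L hL y hy
    have hgξ : Tendsto (fun z => ((-g z : ℝ) : EReal)) (𝓝[Ω] ξ) (𝓝 ((-g ξ : ℝ) : EReal)) :=
      (continuous_coe_real_ereal.tendsto _).comp
        (((hgc ξ hξ).mono subset_closure).neg)
    obtain ⟨y', hyy', hy'⟩ := exists_between (EReal.sub_lt_of_lt_add hy)
    have hlim : Tendsto (fun z => y' + ((-g z : ℝ) : EReal)) (𝓝[Ω] ξ)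
        (𝓝 (y' + ((-g ξ : ℝ) : EReal))) :=
      (EReal.continuousAt_add (p := (y', ((-g ξ : ℝ) : EReal))) (.inr (EReal.coe_ne_bot _))
        (.inr (EReal.coe_ne_top _))).tendsto.comp (tendsto_const_nhds.prodMk_nhds hgξ)
    have hlt' : y < y' + ((-g ξ : ℝ) : EReal) := by
      rwa [EReal.sub_lt_iff (.inl (EReal.coe_ne_bot _)) (.inl (EReal.coe_ne_top _))] at hyy'
    filter_upwards [hlim.eventually_const_lt hlt', hL y' hy'] with z h1 h2
    exact h1.trans_le (add_le_add_left h2.le _)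
  classical
  let H : (Fin n → ℂ) → EReal := fun z =>
    if z ∈ Ω then φ z + ((-g z : ℝ) : EReal) else ((-(3 / 4 * d) : ℝ) : EReal)
  have hH : LowerSemicontinuousOn H (closure Ω) := by
    intro ξ hξ y hy
    by_cases hξΩ : ξ ∈ Ω
    · simp only [H, if_pos hξΩ] at hy
      have := key ξ hξ (φ ξ) (fun y hy => hlsc ξ hξΩ y hy) y hy
      rw [hΩ.nhdsWithin_eq hξΩ] at this
      refine Filter.Eventually.filter_mono nhdsWithin_le_nhds ?_
      filter_upwards [this, hΩ.mem_nhds hξΩ] with z h1 h2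
      simpa only [H, if_pos h2] using h1
    · simp only [H, if_neg hξΩ] at hy
      have hξf : ξ ∈ frontier Ω := ⟨hξ, by rwa [hΩ.interior_eq]⟩
      have hbd : y < lscReg Ω φ ξ + ((-g ξ : ℝ) : EReal) := by
        calc y < ((-(3 / 4 * d) : ℝ) : EReal) := hy
          _ ≤ ((u ξ + -g ξ : ℝ) : EReal) := by
            rw [EReal.coe_le_coe_iff]
            have := hεB ξ hξ
            simp only [hg]
            linarith
          _ ≤ _ := by
            rw [EReal.coe_add]
            exact add_le_add_left (hle ξ hξf) _
      have := key ξ hξ (lscReg Ω φ ξ) (fun y hy => eventually_lt_of_lt_liminf hy) y hbd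
      rw [eventually_nhdsWithin_iff] at this
      refine Filter.Eventually.filter_mono nhdsWithin_le_nhds ?_
      filter_upwards [this] with z h1
      by_cases hz : z ∈ Ω
      · simpa only [H, if_pos hz] using h1 hz
      · simpa only [H, if_neg hz] using hy
  obtain ⟨a, haΩ', hamin⟩ := hH.exists_isMinOn ⟨z₁, subset_closure hz₁⟩ hΩb.isCompact_closure
  have hHz₁ : H a ≤ ((-d : ℝ) : EReal) := by
    refine (hamin (subset_closure hz₁)).trans ?_
    simp only [H, if_pos hz₁, ← hA₁, ← EReal.coe_add, EReal.coe_le_coe_iff, hg, hd]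
    have : 0 ≤ ε * ‖z₁ i‖ ^ 2 := by positivity
    linarith
  have haΩ : a ∈ Ω := by
    by_contra h
    simp only [H, if_neg h, EReal.coe_le_coe_iff] at hHz₁
    linarith
  have hatop : φ a ≠ ⊤ := by
    intro h
    simp only [H, if_pos haΩ, h, EReal.top_add_coe] at hHz₁
    exact (EReal.coe_ne_top _) (top_le_iff.1 hHz₁)
  obtain ⟨A, hA⟩ : ∃ A : ℝ, φ a = A := ⟨_, (EReal.coe_toReal hatop (hbot a haΩ)).symm⟩
  refine not_isMinOn_psupH_sub_psh hΩ hu (huc.mono subset_closure) hφ i hε0 haΩ hA fun z hz => ?_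
  have h := hamin (subset_closure hz)
  simp only [mem_ofPred_eq, H, if_pos haΩ, if_pos hz, hA] at h
  rcases eq_or_ne (φ z) ⊤ with htop | htop
  · simp [htop]
  · lift φ z to ℝ using ⟨htop, hbot z hz⟩ with Z
    norm_cast at h ⊢
    simp only [hg] at h
    linarith

/-- part of Theorem 4.4: let `Ω ⊆ ℂⁿ` be a bounded B-regular domain and
let `φ` be a lower bounded, tame, plurisuperharmonic function on `Ω` with `φ* = φ_*` on
`cl(Ω)`. Then the Perron–Bremermann envelope `Pφ` attains the boundary values of `φ`: for
every `z₀ ∈ ∂Ω`, `lim_{Ω ∋ ζ → z₀} Pφ(ζ) = φ(z₀)` in `[-∞, +∞]` (here `φ(z₀)` is the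
value of the continuous extension of `φ` to `cl(Ω)`, and `φ(z₀) = +∞` is allowed). -/
theorem statement12 {n : ℕ} (Ω : Set (Fin n → ℂ))
    (hΩo : IsOpen Ω) (hΩc : IsConnected Ω) (hΩb : Bornology.IsBounded Ω)
    (hΩreg : BRegular Ω)
    (φ : (Fin n → ℂ) → EReal) (hφ : IsPSupH Ω φ)
    (hlb : ∃ C : ℝ, ∀ z ∈ Ω, (C : EReal) ≤ φ z)
    (htame : Tame Ω φ)
    (hcont : ∀ ξ ∈ closure Ω, uscReg Ω φ ξ = lscReg Ω φ ξ) :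
    ∀ z₀ ∈ frontier Ω,
      Tendsto (Perron Ω φ) (nhdsWithin z₀ Ω) (nhds (lscReg Ω φ z₀)) := by
  intro z₀ hz₀
  have hz₀Ω : z₀ ∉ Ω := by
    rw [hΩo.frontier_eq] at hz₀
    exact hz₀.2
  obtain ⟨i⟩ : Nonempty (Fin n) := by
    by_contra hn
    rw [not_nonempty_iff] at hn
    obtain ⟨z, hz⟩ := hΩc.nonempty
    exact hz₀Ω (Subsingleton.elim z z₀ ▸ hz)
  obtain ⟨c, hc⟩ := hlb
  have hlim : ∀ ξ ∈ closure Ω, Tendsto φ (𝓝[Ω] ξ) (𝓝 (lscReg Ω φ ξ)) := fun ξ hξ =>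
    tendsto_of_liminf_eq_limsup rfl (hcont ξ hξ)
  have hne : ∀ ξ ∈ closure Ω, (𝓝[Ω] ξ).NeBot := fun ξ hξ => mem_closure_iff_nhdsWithin_neBot.1 hξ
  have hreg : ContinuousOn (lscReg Ω φ) (closure Ω) := by
    refine (continuousOn_extendFrom subset_rfl fun ξ hξ => ⟨_, hlim ξ hξ⟩).congr fun ξ hξ => ?_
    have := hne ξ hξ
    exact (extendFrom_eq hξ (hlim ξ hξ)).symm
  have hPle : ∀ z ∈ Ω, Perron Ω φ z ≤ φ z := by
    intro z hz
    have hz' : ∀ {p : (Fin n → ℂ) → Prop}, p z → ∃ᶠ x in 𝓝[Ω] z, p x := fun h =>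
      (frequently_pure.2 h).filter_mono (pure_le_nhdsWithin hz)
    refine sSup_le ?_
    rintro y ⟨u, -, hu, rfl⟩
    calc u z ≤ uscReg Ω u z := le_limsup_of_frequently_le (hz' le_rfl)
      _ ≤ lscReg Ω φ z := hu z (subset_closure hz)
      _ ≤ φ z := liminf_le_of_frequently_le (hz' le_rfl)
  have hlow : ∀ ξ ∈ closure Ω, (c : EReal) ≤ lscReg Ω φ ξ := fun ξ hξ =>
    have := hne ξ hξ
    ge_of_tendsto (hlim ξ hξ) (eventually_mem_nhdsWithin.mono hc)
  refine tendsto_order.2 ⟨fun y hy => ?_, fun y hy => ?_⟩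
  · obtain ⟨m, hym, hmL⟩ := EReal.lt_iff_exists_real_btwn.1 hy
    have hfin : ∀ ξ ∈ closure Ω, ((min (lscReg Ω φ ξ) m).toReal : EReal) = min (lscReg Ω φ ξ) m :=
      fun ξ hξ => EReal.coe_toReal (ne_top_of_le_ne_top (EReal.coe_ne_top m) (min_le_right _ _))
        (ne_bot_of_le_ne_bot (EReal.coe_ne_bot (min c m))
          (le_min
            ((EReal.coe_le_coe_iff.2 (min_le_left c m)).trans (hlow ξ hξ))
            (EReal.coe_le_coe_iff.2 (min_le_right c m))))
    obtain ⟨u, hu, huc, hub⟩ := hΩreg (fun ξ => (min (lscReg Ω φ ξ) m).toReal) (by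
      refine EReal.continuousOn_toReal.comp
        (fun ξ hξ => (hreg.mono frontier_subset_closure ξ hξ).min tendsto_const_nhds) fun ξ hξ => ?_
      have := hfin ξ (frontier_subset_closure hξ)
      simp only [mem_compl_iff, mem_insert_iff, mem_singleton_iff, not_or]
      rw [← this]
      exact ⟨EReal.coe_ne_bot _, EReal.coe_ne_top _⟩)
    have hub' : ∀ ξ ∈ frontier Ω, (u ξ : EReal) = min (lscReg Ω φ ξ) m := fun ξ hξ => by
      rw [hub ξ hξ, hfin ξ (frontier_subset_closure hξ)]
    have hulim : ∀ ξ ∈ closure Ω, Tendsto (fun z => (u z : EReal)) (𝓝[Ω] ξ) (𝓝 (u ξ)) :=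
      fun ξ hξ => (continuous_coe_real_ereal.tendsto _).comp ((huc ξ hξ).mono subset_closure)
    have hule : ∀ z ∈ Ω, (u z : EReal) ≤ φ z :=
      psh_le_psupH_of_frontier_le hΩo hΩb i hu huc hφ fun ξ hξ =>
        (hub' ξ hξ).trans_le (min_le_left _ _)
    have huP : ∀ z, (u z : EReal) ≤ Perron Ω φ z := fun z =>
      le_sSup ⟨fun z => (u z : EReal), hu, fun ξ hξ => by
        have := hne ξ hξ
        rw [uscReg, (hulim ξ hξ).limsup_eq]
        exact le_of_tendsto_of_tendsto (hulim ξ hξ) (hlim ξ hξ)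
          (eventually_mem_nhdsWithin.mono hule), rfl⟩
    have hyu : y < (u z₀ : EReal) := by
      rw [hub' z₀ hz₀]
      exact lt_min hy hym
    filter_upwards [(hulim z₀ (frontier_subset_closure hz₀)).eventually_const_lt hyu] with z hz
    exact hz.trans_le (huP z)
  · filter_upwards [(hlim z₀ (frontier_subset_closure hz₀)).eventually_lt_const hy,
      self_mem_nhdsWithin] with z hz hzΩ
    exact (hPle z hzΩ).trans_lt hz
end
end
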